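/- Let 0 < ε₁ < ε₂ < 1 and let f be a smooth function compactly supported in B_{ε₁,ε₂} ∩ U, where U = {x₃ > 0}, with polar form F. If the spindle interior transform 𝓘f(r,α,β) = ∫₀^{2π} ∫₀^π ∫₀^{√(r² sin²φ+1) − r sin φ} ρ² sin φ (h·F)(ρ,θ,φ) dρ dφ dθ vanishes for all r ∈ (0,∞), α ∈ [0,2π], β ∈ [0,π], then f(x) = 0 for all x with 0 < |x| < 1; in particular f ≡ 0. -/

import Mathlib

noncomputable section
open Real MeasureTheory Set

abbrev R3 := EuclideanSpace ℝ (Fin 3)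

/-- The unit vector with spherical angles `θ` (azimuth) and `φ` (colatitude). -/
def sphVec (θ φ : ℝ) : R3 :=
  (WithLp.equiv 2 (Fin 3 → ℝ)).symm ![sin φ * cos θ, sin φ * sin θ, cos φ]

/-- Rotation about the `x₃` axis by angle `α`. -/
def rotZ (α : ℝ) (x : R3) : R3 :=
  (WithLp.equiv 2 (Fin 3 → ℝ)).symm
    ![cos α * x 0 - sin α * x 1, sin α * x 0 + cos α * x 1, x 2]

/-- Rotation about the `x₂` axis by angle `β`. -/
def rotY (β : ℝ) (x : R3) : R3 :=
  (WithLp.equiv 2 (Fin 3 → ℝ)).symm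
    ![cos β * x 0 + sin β * x 2, x 1, -sin β * x 0 + cos β * x 2]

/-- `h = U(α)V(β)`. -/
def rotUV (α β : ℝ) (x : R3) : R3 := rotZ α (rotY β x)

/-- The hollow ball `B_{a,b} = {x ∈ ℝ³ : a < |x| < b}`. -/
def hollowBall (a b : ℝ) : Set R3 := {x : R3 | a < ‖x‖ ∧ ‖x‖ < b}

/-- The open upper half space `U = {x₃ > 0}`. -/
def upperHalf : Set R3 := {x : R3 | 0 < x 2}

/-- The spindle interior transform `𝓘f`. -/
def interiorT (f : R3 → ℝ) (r α β : ℝ) : ℝ :=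
  ∫ θ in (0:ℝ)..(2 * π), ∫ φ in (0:ℝ)..π,
    ∫ ρ in (0:ℝ)..(Real.sqrt (r ^ 2 * sin φ ^ 2 + 1) - r * sin φ),
      ρ ^ 2 * sin φ * f (ρ • rotUV α β (sphVec θ φ))

section CrossSquare

open Polynomial

lemma two_mul_coeff_two_quadratic_pow {A : Type*} [CommRing A] (a b c : A) (k : ℕ) :
    2 * ((C a + C b * X + C c * X ^ 2 : A[X]) ^ (k + 1)).coeff 2 =
      (k + 1) * k * a ^ (k - 1) * b ^ 2 + 2 * (k + 1) * a ^ k * c := by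
  have h : ∀ P : A[X], 2 * P.coeff 2 = (derivative (derivative P)).eval 0 := by
    intro P
    rw [← coeff_zero_eq_eval_zero, coeff_derivative, coeff_derivative]
    push_cast
    ring
  rw [h]
  simp [derivative_pow]
  ring

variable {A : Type*} [CommRing A] [Algebra ℝ A]

/-- The square of the length of the cross product `w × u`, with `w` having coordinates in an
`ℝ`-algebra. -/
def crossSq (w : Fin 3 → A) (u : Fin 3 → ℝ) : A :=
  (∑ i, w i ^ 2) * algebraMap ℝ A (∑ i, u i ^ 2) - (∑ i, algebraMap ℝ A (u i) * w i) ^ 2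

lemma map_coeff_eq_zero_of_forall_eval (L : A →ₗ[ℝ] ℝ) (P : A[X])
    (h : ∀ t : ℝ, L (P.eval (algebraMap ℝ A t)) = 0) (j : ℕ) : L (P.coeff j) = 0 := by
  have hQ : (∑ i ∈ Finset.range (P.natDegree + 1), monomial i (L (P.coeff i)) : ℝ[X]) = 0 := by
    refine Polynomial.funext fun t => ?_
    rw [eval_zero, ← h t, eval_finsetSum, eval_eq_sum_range, map_sum]
    refine Finset.sum_congr rfl fun i _ => ?_
    rw [eval_monomial, ← map_pow, mul_comm (P.coeff i), ← Algebra.smul_def, map_smul, smul_eq_mul,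
      mul_comm]
  have := congrArg (fun q => coeff q j) hQ
  simp only [finsetSum_coeff, coeff_monomial, Finset.sum_ite_eq', coeff_zero] at this
  by_cases hj : j ∈ Finset.range (P.natDegree + 1)
  · simpa [hj] using this
  · rw [coeff_eq_zero_of_natDegree_lt (by simpa using hj), map_zero]

lemma map_sq_mul_crossSq_pow (w : Fin 3 → A) (k : ℕ) (L : A →ₗ[ℝ] ℝ)
    (h : ∀ u, L (crossSq w u ^ (k + 1)) = 0) (u : Fin 3 → ℝ) :
    L ((∑ i, w i ^ 2) * crossSq w u ^ k) = 0 := by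
  set a := crossSq w u with ha
  set s := ∑ i, w i ^ 2 with hs
  let b : Fin 3 → A := fun i =>
    2 * (s * algebraMap ℝ A (u i) - w i * ∑ j, algebraMap ℝ A (u j) * w j)
  let c : Fin 3 → A := fun i => s - w i ^ 2
  have key : ∀ i, L (((k : A) + 1) * k * a ^ (k - 1) * b i ^ 2
      + 2 * ((k : A) + 1) * a ^ k * c i) = 0 := by
    intro i
    rw [← two_mul_coeff_two_quadratic_pow, two_mul, map_add, ← two_mul,
      map_coeff_eq_zero_of_forall_eval, mul_zero]
    intro t
    rw [← h (u + t • Pi.single i 1)]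
    congr 1
    simp only [eval_pow, eval_add, eval_mul, eval_C, eval_X]
    congr 1
    fin_cases i <;>
      simp [ha, hs, b, c, crossSq, Fin.sum_univ_three] <;> ring
  have hb : ∑ i, b i ^ 2 = 4 * s * a := by
    simp only [b, ha, hs, crossSq, Fin.sum_univ_three, map_add, map_pow]
    ring
  have hc : ∑ i, c i = 2 * s := by
    simp only [c, hs, Fin.sum_univ_three]
    ring
  have hsum : ∑ i, (((k : A) + 1) * k * a ^ (k - 1) * b i ^ 2
      + 2 * ((k : A) + 1) * a ^ k * c i) = (4 * ((k : ℝ) + 1) ^ 2) • (s * a ^ k) := by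
    rw [Finset.sum_add_distrib, ← Finset.mul_sum, ← Finset.mul_sum, hb, hc, Algebra.smul_def]
    have h4 : algebraMap ℝ A 4 = 4 := map_ofNat _ 4
    rcases k with _ | k
    · simp [h4]; ring
    · simp [h4]; ring
  have h0 : L (∑ i, (((k : A) + 1) * k * a ^ (k - 1) * b i ^ 2
      + 2 * ((k : A) + 1) * a ^ k * c i)) = 0 := by
    rw [map_sum]; exact Finset.sum_eq_zero fun i _ => key i
  rw [hsum, map_smul, smul_eq_mul] at h0
  exact (mul_eq_zero.mp h0).resolve_left (by positivity)

lemma map_crossSq_pow_mul_inner_pow (w : Fin 3 → A) (j : ℕ) : ∀ (i : ℕ) (L : A →ₗ[ℝ] ℝ),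
    (∀ u, L (crossSq w u ^ (i + j)) = 0) → ∀ u : Fin 3 → ℝ,
    L (crossSq w u ^ i * (∑ i, algebraMap ℝ A (u i) * w i) ^ (2 * j)) = 0 := by
  induction j with
  | zero => intro i L h u; simpa using h u
  | succ j ih =>
    intro i L h u
    have h1 := ih (i + 1) L (fun u => by rw [← h u]; congr 2; ring) u
    have h2 := ih i (L ∘ₗ LinearMap.mulLeft ℝ (∑ i, w i ^ 2))
      (fun u => map_sq_mul_crossSq_pow w (i + j) L h u) u
    have h3 : crossSq w u ^ i * (∑ i, algebraMap ℝ A (u i) * w i) ^ (2 * (j + 1)) =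
        (∑ i, u i ^ 2) • ((∑ i, w i ^ 2) *
          (crossSq w u ^ i * (∑ i, algebraMap ℝ A (u i) * w i) ^ (2 * j))) -
        crossSq w u ^ (i + 1) * (∑ i, algebraMap ℝ A (u i) * w i) ^ (2 * j) := by
      rw [Algebra.smul_def, pow_succ (crossSq w u)]
      nth_rw 4 [crossSq]
      ring
    rw [h3, map_sub, map_smul, h1]
    simp only [LinearMap.comp_apply, LinearMap.mulLeft_apply] at h2
    rw [h2]
    simp

/-- A functional annihilating all `|w × u| ^ (2 k)` annihilates all `(w · u) ^ (2 k)`. -/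
lemma map_inner_pow_eq_zero (w : Fin 3 → A) (k : ℕ) (L : A →ₗ[ℝ] ℝ)
    (h : ∀ u, L (crossSq w u ^ k) = 0) (u : Fin 3 → ℝ) :
    L ((∑ i, algebraMap ℝ A (u i) * w i) ^ (2 * k)) = 0 := by
  simpa using map_crossSq_pow_mul_inner_pow w k 0 L (by simpa using h) u

end CrossSquare

section CosineDensity

variable {X : Type*} [TopologicalSpace X]

/-- The cosine of a continuous real function. -/
def cosMap (p : C(X, ℝ)) : C(X, ℝ) := ⟨fun x => cos (p x), by fun_prop⟩

@[simp] lemma cosMap_apply (p : C(X, ℝ)) (x : X) : cosMap p x = cos (p x) := rfl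

lemma cosMap_mul_cosMap (p q : C(X, ℝ)) :
    cosMap p * cosMap q = (1 / 2 : ℝ) • (cosMap (p + q) + cosMap (p - q)) := by
  ext x
  simp [cos_add, cos_sub]
  ring

lemma hasSum_cosMap [CompactSpace X] (p : C(X, ℝ)) :
    HasSum (fun k : ℕ => ((-1) ^ k / (Nat.factorial (2 * k) : ℝ)) • p ^ (2 * k)) (cosMap p) := by
  have hs : Summable fun k : ℕ => ((-1) ^ k / (Nat.factorial (2 * k) : ℝ)) • p ^ (2 * k) := by
    refine Summable.of_norm_bounded
      ((Real.summable_pow_div_factorial ‖p‖).comp_injective (mul_right_injective₀ two_ne_zero))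
      fun k => ?_
    refine (ContinuousMap.norm_le _ (by simp only [Function.comp_apply]; positivity)).2 fun x => ?_
    have : |p x| ^ (2 * k) ≤ ‖p‖ ^ (2 * k) := by
      gcongr
      exact p.norm_coe_le_norm x
    simp only [ContinuousMap.smul_apply, ContinuousMap.pow_apply, smul_eq_mul, norm_mul, norm_div,
      norm_pow, norm_neg, norm_one, one_pow, Real.norm_eq_abs, Nat.abs_cast, Function.comp_apply]
    rw [one_div, inv_mul_eq_div]
    gcongr
  have := hs.hasSum
  convert this using 1
  ext x
  refine (ContinuousMap.hasSum_apply this x).unique ?_ |>.symm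
  simpa [mul_comm, div_mul_eq_mul_div, mul_div_assoc] using Real.hasSum_cos (p x)

/-- The span of the functions `cos (u · w)` as a subalgebra. -/
def cosSubalgebra (w : Fin 3 → C(X, ℝ)) : Subalgebra ℝ C(X, ℝ) :=
  (Submodule.span ℝ (range fun u : Fin 3 → ℝ => cosMap (∑ i, u i • w i))).toSubalgebra
    (Submodule.subset_span ⟨0, by ext x; simp⟩)
    (by
      intro p q hp hq
      have h := Submodule.mul_mem_mul hp hq
      rw [Submodule.span_mul_span] at h
      refine Submodule.span_le.2 ?_ h
      rintro _ ⟨_, ⟨u, rfl⟩, _, ⟨v, rfl⟩, rfl⟩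
      simp only [cosMap_mul_cosMap, SetLike.mem_coe]
      refine Submodule.smul_mem _ _ (Submodule.add_mem _
        (Submodule.subset_span ⟨u + v, ?_⟩) (Submodule.subset_span ⟨u - v, ?_⟩))
      · simp [add_smul, Finset.sum_add_distrib]
      · simp [sub_smul, Finset.sum_sub_distrib])

lemma exists_pos_of_ne {a b : Fin 3 → ℝ} (ha : 0 < a 2) (hb : 0 < b 2) (hab : a ≠ b) :
    ∃ u : Fin 3 → ℝ, 0 < ∑ i, u i * a i ∧ 0 < ∑ i, u i * b i ∧
      ∑ i, u i * a i ≠ ∑ i, u i * b i := by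
  by_cases h2 : a 2 = b 2
  · obtain ⟨i, hi⟩ := Function.ne_iff.1 hab
    have hM : (|a i| + |b i| + 1) / a 2 * a 2 = |a i| + |b i| + 1 := div_mul_cancel₀ _ ha.ne'
    have h : ∀ c : Fin 3 → ℝ, ∑ j, (Pi.single 2 ((|a i| + |b i| + 1) / a 2) + Pi.single i 1 :
        Fin 3 → ℝ) j * c j = (|a i| + |b i| + 1) / a 2 * c 2 + c i := by
      intro c
      simp [add_mul, Finset.sum_add_distrib, Pi.single_apply]
    refine ⟨Pi.single 2 ((|a i| + |b i| + 1) / a 2) + Pi.single i 1, ?_, ?_, ?_⟩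
    · rw [h, hM]; linarith [neg_abs_le (a i), abs_nonneg (b i)]
    · rw [h, ← h2, hM]; linarith [neg_abs_le (b i), abs_nonneg (a i)]
    · rw [h, h, ← h2]; simpa using hi
  · exact ⟨Pi.single 2 1, by simpa [Pi.single_apply], by simpa [Pi.single_apply],
      by simpa [Pi.single_apply]⟩

lemma cosSubalgebra_separatesPoints (w : Fin 3 → C(X, ℝ)) (hpos : ∀ x, 0 < w 2 x)
    (hinj : Function.Injective fun x i => w i x) : (cosSubalgebra w).SeparatesPoints := by
  intro x y hxy
  obtain ⟨u, hux, huy, hne⟩ := exists_pos_of_ne (hpos x) (hpos y) (hinj.ne hxy)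
  set p := ∑ i, u i * w i x
  set q := ∑ i, u i * w i y
  have hpq : 0 < p + q := by positivity
  have hv : ∀ z, (∑ i, ((p + q)⁻¹ • u) i • w i) z = (p + q)⁻¹ * ∑ i, u i * w i z := by
    intro z
    simp [Finset.mul_sum, mul_assoc]
  have hmem : ∀ r, 0 < r → r ≤ p + q → (p + q)⁻¹ * r ∈ Icc 0 π := by
    intro r hr hr'
    refine ⟨by positivity, le_trans ?_ (by linarith [pi_gt_three] : (1 : ℝ) ≤ π)⟩
    rw [inv_mul_le_iff₀ hpq]
    linarith
  refine ⟨_, ⟨_, Submodule.subset_span ⟨(p + q)⁻¹ • u, rfl⟩, rfl⟩, fun h => hne ?_⟩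
  simp only [cosMap_apply, hv] at h
  exact mul_left_cancel₀ (inv_ne_zero hpq.ne')
    (injOn_cos (hmem p hux (by linarith)) (hmem q huy (by linarith)) h)

lemma eq_zero_of_map_crossSq_pow [CompactSpace X] (w : Fin 3 → C(X, ℝ)) (hpos : ∀ x, 0 < w 2 x)
    (hinj : Function.Injective fun x i => w i x) (L : C(X, ℝ) →L[ℝ] ℝ)
    (h : ∀ u k, L (crossSq w u ^ k) = 0) : L = 0 := by
  have hcos : ∀ u : Fin 3 → ℝ, L (cosMap (∑ i, u i • w i)) = 0 := by
    intro u
    refine ((hasSum_cosMap (∑ i, u i • w i)).mapL L).unique ?_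
    convert hasSum_zero using 2 with k
    have := map_inner_pow_eq_zero w k L.toLinearMap (fun u => h u k) u
    simp only [← Algebra.smul_def] at this
    rw [map_smul, smul_eq_zero]
    exact Or.inr this
  have hker : (cosSubalgebra w : Set C(X, ℝ)) ⊆ {g | L g = 0} := by
    have : Submodule.span ℝ (range fun u : Fin 3 → ℝ => cosMap (∑ i, u i • w i)) ≤
        LinearMap.ker L.toLinearMap := by
      rw [Submodule.span_le]
      rintro _ ⟨u, rfl⟩
      exact hcos u
    exact this
  have hcl := closure_minimal hker (isClosed_eq L.continuous continuous_const)
  have htop := ContinuousMap.subalgebra_topologicalClosure_eq_top_of_separatesPoints _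
    (cosSubalgebra_separatesPoints w hpos hinj)
  ext g
  have hg : g ∈ (cosSubalgebra w).topologicalClosure := htop ▸ Algebra.mem_top
  exact hcl hg

end CosineDensity

section SphericalIntegral

lemma integrable_of_bounded_of_forall_notMem {α : Type*} [MeasurableSpace α] {μ : Measure α}
    {s : Set α} (hs : μ s < ⊤) {F : α → ℝ} (hF : Measurable F) (C : ℝ)
    (hC : ∀ x, |F x| ≤ C) (h0 : ∀ x, x ∉ s → F x = 0) : Integrable F μ :=
  (integrableOn_iff_integrable_of_support_subset (Function.support_subset_iff'.2 h0)).1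
    (Measure.integrableOn_of_bounded hs.ne hF.aestronglyMeasurable
      (Filter.Eventually.of_forall hC))

/-- The point with cartesian coordinates `a`, `b`, `c`. -/
def mkR3 (a b c : ℝ) : R3 := WithLp.toLp 2 ![a, b, c]

lemma measurable_mkR3 : Measurable fun p : ℝ × ℝ × ℝ => mkR3 p.2.1 p.2.2 p.1 := by
  have : Continuous fun p : ℝ × ℝ × ℝ => mkR3 p.2.1 p.2.2 p.1 := by
    unfold mkR3
    refine (PiLp.continuous_toLp 2 _).comp (continuous_pi fun i => ?_)
    fin_cases i <;> simp <;> fun_prop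
  exact this.measurable

lemma norm_mkR3_sq (a b c : ℝ) : ‖mkR3 a b c‖ ^ 2 = a ^ 2 + b ^ 2 + c ^ 2 := by
  simp [mkR3, EuclideanSpace.real_norm_sq_eq, Fin.sum_univ_three]

lemma measurePreserving_mkR3 : MeasurePreserving fun p : ℝ × ℝ × ℝ => mkR3 p.2.1 p.2.2 p.1 := by
  have h := (PiLp.volume_preserving_toLp (Fin 3)).comp
    ((volume_preserving_piFinSuccAbove (fun _ : Fin 3 => ℝ) 2).symm.comp
      ((MeasurePreserving.id (volume : Measure ℝ)).prod
        (volume_preserving_piFinTwo (fun _ : Fin 2 => ℝ)).symm))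
  convert h using 1
  · ext p i
    fin_cases i <;> rfl
  · rfl

lemma integral_eq_integral_mkR3 (G : R3 → ℝ) (hG : Integrable G) :
    ∫ x, G x = ∫ z, ∫ p : ℝ × ℝ, G (mkR3 p.1 p.2 z) := by
  have hi := measurePreserving_mkR3.integrable_comp_of_integrable hG
  rw [← measurePreserving_mkR3.map_eq, integral_map measurable_mkR3.aemeasurable
    (measurePreserving_mkR3.map_eq ▸ hG.aestronglyMeasurable)]
  exact integral_prod _ hi

/-- The integrand of the integral in cylindrical coordinates `(z, σ, θ)`, extended by zero. -/
def cylIntegrand (G : R3 → ℝ) (z σ θ : ℝ) : ℝ :=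
  if 0 < σ then σ * G (mkR3 (σ * cos θ) (σ * sin θ) z) else 0

lemma measurable_cylIntegrand {G : R3 → ℝ} (hG : Measurable G) :
    Measurable fun p : ℝ × ℝ × ℝ => cylIntegrand G p.1 p.2.1 p.2.2 := by
  unfold cylIntegrand
  refine Measurable.ite (measurableSet_lt measurable_const (by fun_prop)) ?_ measurable_const
  refine Measurable.mul (by fun_prop) (hG.comp (measurable_mkR3.comp
    (f := fun p : ℝ × ℝ × ℝ => (p.1, p.2.1 * cos p.2.2, p.2.1 * sin p.2.2)) ?_))
  fun_prop

lemma cylIntegrand_eq_zero {G : R3 → ℝ} (h0 : ∀ x, 1 ≤ ‖x‖ → G x = 0) {z σ θ : ℝ}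
    (h : 1 ≤ z ^ 2 + σ ^ 2) : cylIntegrand G z σ θ = 0 := by
  rw [cylIntegrand, h0, mul_zero, ite_self]
  rw [← one_le_sq_iff₀ (norm_nonneg _), norm_mkR3_sq]
  nlinarith [sin_sq_add_cos_sq θ]

lemma abs_cylIntegrand_le {G : R3 → ℝ} (h0 : ∀ x, 1 ≤ ‖x‖ → G x = 0) {C : ℝ}
    (hC : ∀ x, |G x| ≤ C) (z σ θ : ℝ) : |cylIntegrand G z σ θ| ≤ C := by
  have hC0 : 0 ≤ C := (abs_nonneg _).trans (hC 0)
  rcases le_or_gt 1 (z ^ 2 + σ ^ 2) with h | h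
  · simpa [cylIntegrand_eq_zero h0 h] using hC0
  · unfold cylIntegrand
    split_ifs with hσ
    · have hσ1 : σ ≤ 1 := by nlinarith
      rw [abs_mul, abs_of_pos hσ]
      exact (mul_le_of_le_one_left (abs_nonneg _) hσ1).trans (hC _)
    · simpa using hC0

lemma integral_eq_integral_cylIntegrand (G : R3 → ℝ) (hG : Measurable G) (C : ℝ)
    (hC : ∀ x, |G x| ≤ C) (h0 : ∀ x, 1 ≤ ‖x‖ → G x = 0) :
    ∫ x, G x = ∫ θ in Ioo (-π) π, ∫ p : ℝ × ℝ, cylIntegrand G p.1 p.2 θ := by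
  have hGi : Integrable G := integrable_of_bounded_of_forall_notMem
    (measure_ball_lt_top (x := (0 : R3)) (r := 1)) hG C hC
    (fun x hx => h0 x (by simpa using hx))
  set ν := (volume : Measure ℝ).restrict (Ioo (-π) π) with hν
  have hJ : Integrable (fun p : ℝ × ℝ × ℝ => cylIntegrand G p.1 p.2.1 p.2.2)
      ((volume : Measure ℝ).prod ((volume : Measure ℝ).prod ν)) := by
    refine integrable_of_bounded_of_forall_notMem
      (s := Icc (-1) 1 ×ˢ (Icc (-1) 1 ×ˢ univ)) ?_ (measurable_cylIntegrand hG) C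
      (fun p => abs_cylIntegrand_le h0 hC _ _ _) ?_
    · rw [Measure.prod_prod, Measure.prod_prod]
      exact ENNReal.mul_lt_top (by simp) (ENNReal.mul_lt_top (by simp) (measure_lt_top _ _))
    · rintro ⟨z, σ, θ⟩ hp
      refine cylIntegrand_eq_zero h0 ?_
      by_contra! hlt
      refine hp ⟨abs_le.1 (abs_le_one_iff_mul_self_le_one.2 ?_),
        abs_le.1 (abs_le_one_iff_mul_self_le_one.2 ?_), mem_univ _⟩ <;>
        dsimp only <;> nlinarith [sq_nonneg z, sq_nonneg σ]
  have hpol : ∀ z, ∫ p : ℝ × ℝ, G (mkR3 p.1 p.2 z) =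
      ∫ q, cylIntegrand G z q.1 q.2 ∂((volume : Measure ℝ).prod ν) := by
    intro z
    rw [← integral_comp_polarCoord_symm, polarCoord_target, hν,
      ← Measure.restrict_univ (μ := (volume : Measure ℝ)), Measure.prod_restrict,
      Measure.restrict_univ, ← Measure.volume_eq_prod]
    rw [← integral_indicator (by measurability), ← integral_indicator (by measurability)]
    congr 1
    ext q
    by_cases h1 : 0 < q.1 <;> by_cases h2 : q.2 ∈ Ioo (-π) π <;>
      simp [indicator, h1, h2, cylIntegrand]
  rw [integral_eq_integral_mkR3 G hGi]
  simp only [hpol]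
  have hassoc := measurePreserving_prodAssoc (volume : Measure ℝ) (volume : Measure ℝ) ν
  have hJ' := hassoc.integrable_comp_of_integrable hJ
  rw [← integral_prod _ hJ, ← hassoc.integral_comp']
  exact integral_prod_symm _ hJ'

/-- Integration over the unit ball in spherical coordinates. -/
lemma integral_eq_spherical (G : R3 → ℝ) (hG : Measurable G) (C : ℝ)
    (hC : ∀ x, |G x| ≤ C) (h0 : ∀ x, 1 ≤ ‖x‖ → G x = 0) :
    ∫ x, G x = ∫ θ in (0 : ℝ)..(2 * π), ∫ φ in (0 : ℝ)..π, ∫ ρ in Ioi (0 : ℝ),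
      ρ ^ 2 * sin φ * G (ρ • sphVec θ φ) := by
  have hsph : ∀ ρ θ φ : ℝ, ρ • sphVec θ φ =
      mkR3 (ρ * sin φ * cos θ) (ρ * sin φ * sin θ) (ρ * cos φ) := by
    intro ρ θ φ
    ext i
    fin_cases i <;> simp [sphVec, mkR3, mul_assoc]
  have hθ : ∀ θ, ∫ p : ℝ × ℝ, cylIntegrand G p.1 p.2 θ = ∫ φ in (0 : ℝ)..π,
      ∫ ρ in Ioi (0 : ℝ), ρ ^ 2 * sin φ * G (ρ • sphVec θ φ) := by
    intro θ
    have hm : Measurable fun q : ℝ × ℝ =>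
        q.1 * cylIntegrand G (q.1 * cos q.2) (q.1 * sin q.2) θ := by
      refine Measurable.mul (by fun_prop) ((measurable_cylIntegrand hG).comp
        (f := fun q : ℝ × ℝ => (q.1 * cos q.2, q.1 * sin q.2, θ)) ?_)
      fun_prop
    have hzero : ∀ q : ℝ × ℝ, 1 ≤ |q.1| →
        cylIntegrand G (q.1 * cos q.2) (q.1 * sin q.2) θ = 0 := by
      intro q hq
      refine cylIntegrand_eq_zero h0 ?_
      have : 1 ≤ q.1 ^ 2 := (one_le_sq_iff_one_le_abs _).2 hq
      nlinarith [sin_sq_add_cos_sq q.2]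
    have hi : Integrable (fun q : ℝ × ℝ =>
        q.1 * cylIntegrand G (q.1 * cos q.2) (q.1 * sin q.2) θ)
        (((volume : Measure ℝ).restrict (Ioi 0)).prod
          ((volume : Measure ℝ).restrict (Ioo (-π) π))) := by
      refine integrable_of_bounded_of_forall_notMem (s := Ioo (-1) 1 ×ˢ univ) ?_ hm C ?_ ?_
      · rw [Measure.prod_prod]
        refine ENNReal.mul_lt_top ((Measure.restrict_apply_le _ _).trans_lt (by simp))
          (measure_lt_top _ _)
      · intro q
        rcases le_or_gt 1 |q.1| with h | h
        · simpa [hzero q h] using (abs_nonneg _).trans (hC 0)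
        · rw [abs_mul]
          exact (mul_le_of_le_one_left (abs_nonneg _) h.le).trans (abs_cylIntegrand_le h0 hC _ _ _)
      · intro q hq
        rw [hzero q, mul_zero]
        by_contra! hlt
        exact hq ⟨abs_lt.1 hlt, mem_univ _⟩
    rw [← integral_comp_polarCoord_symm, polarCoord_target, Measure.volume_eq_prod,
      ← Measure.prod_restrict]
    simp only [polarCoord_symm_apply, smul_eq_mul]
    rw [integral_prod_symm _ hi, intervalIntegral.integral_of_le pi_pos.le,
      integral_Ioc_eq_integral_Ioo, ← integral_indicator measurableSet_Ioo,
      ← integral_indicator measurableSet_Ioo]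
    congr 1
    ext φ
    by_cases h1 : φ ∈ Ioo 0 π
    · have h2 : φ ∈ Ioo (-π) π := ⟨by linarith [h1.1, pi_pos], h1.2⟩
      rw [indicator_of_mem h1, indicator_of_mem h2]
      refine setIntegral_congr_fun measurableSet_Ioi fun ρ hρ => ?_
      have : 0 < ρ * sin φ := mul_pos hρ (sin_pos_of_mem_Ioo h1)
      simp only [cylIntegrand, this, if_true, hsph]
      ring
    · rw [indicator_of_notMem h1]
      by_cases h2 : φ ∈ Ioo (-π) π
      · rw [indicator_of_mem h2]
        refine setIntegral_eq_zero_of_forall_eq_zero fun ρ hρ => ?_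
        have hφ : φ ≤ 0 := by
          by_contra! h
          exact h1 ⟨h, h2.2⟩
        have : ¬ 0 < ρ * sin φ := not_lt.2 (mul_nonpos_of_nonneg_of_nonpos (le_of_lt hρ)
          (sin_nonpos_of_nonpos_of_neg_pi_le hφ h2.1.le))
        simp [cylIntegrand, this]
      · rw [indicator_of_notMem h2]
  rw [integral_eq_integral_cylIntegrand G hG C hC h0]
  simp only [hθ]
  rw [← integral_Ioc_eq_integral_Ioo, ← intervalIntegral.integral_of_le (by linarith [pi_pos])]
  have hper : Function.Periodic (fun θ => ∫ φ in (0 : ℝ)..π, ∫ ρ in Ioi (0 : ℝ),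
      ρ ^ 2 * sin φ * G (ρ • sphVec θ φ)) (2 * π) := by
    intro θ
    simp [sphVec]
  have := hper.intervalIntegral_add_eq (-π) 0
  rw [zero_add] at this
  rw [← this]
  congr 1
  ring

end SphericalIntegral

section InteriorTransform

lemma exists_sphVec_smul (u : R3) : ∃ c : ℝ, ∃ α ∈ Icc 0 (2 * π), ∃ β ∈ Icc 0 π,
    u = c • sphVec α β := by
  set z : ℂ := ⟨u 0, u 1⟩ with hz
  obtain ⟨α, hα, hcos, hsin⟩ : ∃ α ∈ Icc 0 (2 * π), ‖z‖ * cos α = u 0 ∧ ‖z‖ * sin α = u 1 := by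
    rcases le_or_gt 0 z.arg with h | h
    · exact ⟨z.arg, ⟨h, by linarith [z.arg_le_pi, pi_pos]⟩,
        Complex.norm_mul_cos_arg z, Complex.norm_mul_sin_arg z⟩
    · refine ⟨z.arg + 2 * π, ⟨by linarith [z.neg_pi_lt_arg, pi_pos], by linarith⟩, ?_, ?_⟩
      · rw [cos_add_two_pi]; exact Complex.norm_mul_cos_arg z
      · rw [sin_add_two_pi]; exact Complex.norm_mul_sin_arg z
  set y : ℂ := ⟨u 2, ‖z‖⟩ with hy
  refine ⟨‖y‖, α, hα, y.arg, ⟨Complex.arg_nonneg_iff.2 (norm_nonneg z), y.arg_le_pi⟩, ?_⟩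
  ext i
  fin_cases i
  · simp [sphVec, ← mul_assoc, hy, hcos]
  · simp [sphVec, ← mul_assoc, hy, hsin]
  · simp [sphVec, hy]

lemma norm_rotUV (α β : ℝ) (x : R3) : ‖rotUV α β x‖ = ‖x‖ := by
  rw [← sq_eq_sq₀ (norm_nonneg _) (norm_nonneg _), EuclideanSpace.real_norm_sq_eq,
    EuclideanSpace.real_norm_sq_eq]
  simp only [rotUV, rotZ, rotY, Fin.sum_univ_three, WithLp.equiv_symm_apply,
    Matrix.cons_val_zero, Matrix.cons_val_one, Matrix.cons_val]
  linear_combination (((cos β * x 0 + sin β * x 2) ^ 2 + x 1 ^ 2)) * sin_sq_add_cos_sq α +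
    (x 0 ^ 2 + x 2 ^ 2) * sin_sq_add_cos_sq β

lemma sum_sphVec_mul_rotUV (α β : ℝ) (x : R3) :
    ∑ i, sphVec α β i * rotUV α β x i = x 2 := by
  simp only [sphVec, rotUV, rotZ, rotY, Fin.sum_univ_three, WithLp.equiv_symm_apply,
    Matrix.cons_val_zero, Matrix.cons_val_one, Matrix.cons_val]
  linear_combination (sin β * (cos β * x 0 + sin β * x 2)) * sin_sq_add_cos_sq α +
    x 2 * sin_sq_add_cos_sq β

/-- `rotUV α β` as a linear isometry. -/
def rotIso (α β : ℝ) : R3 →ₗᵢ[ℝ] R3 where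
  toFun := rotUV α β
  map_add' x y := by
    ext i
    fin_cases i <;> simp [rotUV, rotZ, rotY] <;> ring
  map_smul' c x := by
    ext i
    fin_cases i <;> simp [rotUV, rotZ, rotY] <;> ring
  norm_map' := norm_rotUV α β

lemma integral_comp_rotUV (α β : ℝ) (G : R3 → ℝ) : ∫ x, G (rotUV α β x) = ∫ x, G x := by
  let e : R3 ≃ₗᵢ[ℝ] R3 := (rotIso α β).toLinearIsometryEquiv rfl
  exact e.measurePreserving.integral_comp e.toHomeomorph.measurableEmbedding G

lemma norm_sphVec (θ φ : ℝ) : ‖sphVec θ φ‖ = 1 := by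
  rw [← sq_eq_sq₀ (norm_nonneg _) zero_le_one, EuclideanSpace.real_norm_sq_eq]
  simp only [sphVec, Fin.sum_univ_three, WithLp.equiv_symm_apply,
    Matrix.cons_val_zero, Matrix.cons_val_one, Matrix.cons_val]
  linear_combination (sin φ ^ 2) * sin_sq_add_cos_sq θ + sin_sq_add_cos_sq φ

lemma crossSq_rotUV (α β : ℝ) (x : R3) :
    crossSq (fun i => rotUV α β x i) (sphVec α β) = ‖x‖ ^ 2 - x 2 ^ 2 := by
  simp only [crossSq, Algebra.algebraMap_self, RingHom.id_apply, sum_sphVec_mul_rotUV]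
  rw [← EuclideanSpace.real_norm_sq_eq, ← EuclideanSpace.real_norm_sq_eq, norm_rotUV, norm_sphVec]
  ring

lemma sqrt_crossSq_rotUV_smul_sphVec (α β θ : ℝ) {ρ φ : ℝ} (hρ : 0 ≤ ρ) (hφ : φ ∈ Icc 0 π) :
    √(crossSq (fun i => rotUV α β (ρ • sphVec θ φ) i) (sphVec α β)) = ρ * sin φ := by
  rw [crossSq_rotUV, norm_smul, norm_sphVec, ← sqrt_sq (mul_nonneg hρ (sin_nonneg_of_mem_Icc hφ))]
  congr 1
  simp only [sphVec, WithLp.equiv_symm_apply, PiLp.smul_apply, smul_eq_mul, Matrix.cons_val,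
    Real.norm_eq_abs, mul_one, sq_abs]
  linear_combination (-ρ ^ 2) * sin_sq_add_cos_sq φ

lemma sq_add_mul_lt_one_iff {r s ρ : ℝ} (hρ : 0 < ρ) :
    ρ ^ 2 + 2 * r * (ρ * s) < 1 ↔ ρ < √(r ^ 2 * s ^ 2 + 1) - r * s := by
  have h := sq_sqrt (show 0 ≤ r ^ 2 * s ^ 2 + 1 by positivity)
  have h1 : |r * s| < √(r ^ 2 * s ^ 2 + 1) := by
    rw [← sqrt_sq_eq_abs]
    exact sqrt_lt_sqrt (sq_nonneg _) (by nlinarith)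
  set q := √(r ^ 2 * s ^ 2 + 1)
  have h2 := abs_lt.1 h1
  have h3 : ρ ^ 2 + 2 * r * (ρ * s) - 1 = (ρ + r * s - q) * (ρ + r * s + q) := by
    linear_combination h
  have h4 : 0 < ρ + r * s + q := by linarith
  rw [← sub_neg, h3, ← not_le, mul_nonneg_iff_of_pos_right h4, sub_nonneg, not_le,
    lt_sub_iff_add_lt]

lemma measurable_crossSq (u : Fin 3 → ℝ) : Measurable fun x : R3 => crossSq (fun i => x i) u := by
  simp only [crossSq, Algebra.algebraMap_self, RingHom.id_apply]
  fun_prop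

/-- The interior transform integrates over a spindle with axis `sphVec α β`. -/
lemma interiorT_eq_integral {f : R3 → ℝ} (hf : Measurable f) (C : ℝ) (hC : ∀ x, |f x| ≤ C)
    {r : ℝ} (hr : 0 < r) (α β : ℝ) :
    interiorT f r α β = ∫ x : R3,
      if ‖x‖ ^ 2 + 2 * r * √(crossSq (fun i => x i) (sphVec α β)) < 1 then f x else 0 := by
  set K : R3 → ℝ := fun x =>
    if ‖x‖ ^ 2 + 2 * r * √(crossSq (fun i => x i) (sphVec α β)) < 1 then f x else 0 with hK
  have hKm : Measurable K := by
    refine Measurable.ite (measurableSet_lt ?_ measurable_const) hf measurable_const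
    have := (measurable_crossSq (sphVec α β)).sqrt
    fun_prop
  have hrot : Measurable (rotUV α β) := (rotIso α β).continuous.measurable
  refine Eq.trans ?_ ((integral_eq_spherical (K ∘ rotUV α β) (hKm.comp hrot) C ?_ ?_).symm.trans
    (integral_comp_rotUV α β K))
  · unfold interiorT
    refine intervalIntegral.integral_congr fun θ _ => intervalIntegral.integral_congr fun φ hφ => ?_
    rw [uIcc_of_le pi_pos.le] at hφ
    set R := √(r ^ 2 * sin φ ^ 2 + 1) - r * sin φ with hR
    have hR0 : 0 ≤ R := by
      rw [hR, sub_nonneg]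
      exact le_sqrt_of_sq_le (by nlinarith)
    rw [intervalIntegral.integral_of_le hR0, integral_Ioc_eq_integral_Ioo,
      ← integral_indicator measurableSet_Ioo, ← integral_indicator measurableSet_Ioi]
    congr 1
    ext ρ
    by_cases hρ : 0 < ρ
    · rw [indicator_of_mem (mem_Ioi.2 hρ), indicator_apply]
      simp only [hK, Function.comp_apply, sqrt_crossSq_rotUV_smul_sphVec α β θ hρ.le hφ, norm_rotUV,
        norm_smul, norm_sphVec, mul_one, Real.norm_eq_abs, sq_abs, sq_add_mul_lt_one_iff hρ,
        ← hR, mem_Ioo, hρ, true_and, mul_ite, mul_zero]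
      have hsm : rotUV α β (ρ • sphVec θ φ) = ρ • rotUV α β (sphVec θ φ) :=
        (rotIso α β).map_smul ρ _
      rw [hsm]
    · rw [indicator_of_notMem fun h => hρ h.1, indicator_of_notMem (by simpa using hρ)]
  · intro x
    simp only [hK, Function.comp_apply]
    split_ifs
    · exact hC _
    · simpa using (abs_nonneg _).trans (hC 0)
  · intro x hx
    simp only [hK, Function.comp_apply, norm_rotUV]
    rw [if_neg]
    have : 1 ≤ ‖x‖ ^ 2 := one_le_pow₀ hx
    have h2 := mul_nonneg hr.le
      (sqrt_nonneg (crossSq (fun i => rotUV α β x i) (sphVec α β)))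
    linarith

end InteriorTransform

section LevelSets

lemma integral_mul_comp_eq_zero {X : Type*} [MeasurableSpace X] {μ : Measure X} {F t : X → ℝ}
    (hFm : Measurable F) (hF : Integrable F μ) (ht : Measurable t) {B : ℝ}
    (htB : ∀ x, t x ∈ Icc 0 B) (h : ∀ s, 0 < s → ∫ x in {x | t x < s}, F x ∂μ = 0)
    {ψ : ℝ → ℝ} (hψ : Continuous ψ) : ∫ x, F x * ψ (t x) ∂μ = 0 := by
  have hpos : Integrable (fun x => max (F x) 0) μ := hF.pos_part
  have hneg : Integrable (fun x => max (-F x) 0) μ := hF.neg_part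
  have hsub : ∀ x, F x = max (F x) 0 - max (-F x) 0 := fun x =>
    (max_zero_sub_max_neg_zero_eq_self (F x)).symm
  let ν (G : X → ℝ) : Measure ℝ := (μ.withDensity fun x => ENNReal.ofReal (G x)).map t
  have hfin : ∀ G : X → ℝ, Integrable G μ → IsFiniteMeasure (ν G) := fun G hG =>
    have : IsFiniteMeasure (μ.withDensity fun x => ENNReal.ofReal (G x)) :=
      isFiniteMeasure_withDensity_ofReal hG.2
    Measure.isFiniteMeasure_map _ _
  have hset : ∀ S, MeasurableSet S → ∫ x in t ⁻¹' S, F x ∂μ = 0 →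
      ν (fun x => max (F x) 0) S = ν (fun x => max (-F x) 0) S := by
    intro S hS h0
    simp only [ν]
    rw [Measure.map_apply ht hS, Measure.map_apply ht hS, withDensity_apply _ (ht hS),
      withDensity_apply _ (ht hS),
      ← ofReal_integral_eq_lintegral_ofReal hpos.restrict
        (Filter.Eventually.of_forall fun x => le_max_right _ _),
      ← ofReal_integral_eq_lintegral_ofReal hneg.restrict
        (Filter.Eventually.of_forall fun x => le_max_right _ _)]
    congr 1
    rw [← sub_eq_zero, ← integral_sub hpos.restrict hneg.restrict]
    exact (integral_congr_ae (Filter.Eventually.of_forall fun x => (hsub x).symm)).trans h0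
  have huniv : ∫ x, F x ∂μ = 0 := by
    rcases isEmpty_or_nonempty X with hX | ⟨⟨x⟩⟩
    · simp [Measure.eq_zero_of_isEmpty μ]
    · have hB : 0 < B + 1 := by linarith [(htB x).1, (htB x).2]
      rw [← h (B + 1) hB, show {x | t x < B + 1} = univ from
        eq_univ_of_forall fun x => (htB x).2.trans_lt (lt_add_one B), setIntegral_univ]
  have heq : ν (fun x => max (F x) 0) = ν (fun x => max (-F x) 0) := by
    have := hfin _ hpos
    refine Measure.ext_of_Ici _ _ fun a => hset _ measurableSet_Ici ?_
    rcases le_or_gt a 0 with ha | ha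
    · rw [show t ⁻¹' Ici a = univ from eq_univ_of_forall fun x => ha.trans (htB x).1,
        setIntegral_univ, huniv]
    · have hc : t ⁻¹' Ici a = {x | t x < a}ᶜ := by ext; simp
      have := integral_add_compl
        (measurableSet_lt ht measurable_const : MeasurableSet {x | t x < a}) hF
      rw [hc]
      linarith [h a ha]
  have hint : ∀ G : X → ℝ, Measurable G → (∀ x, 0 ≤ G x) →
      ∫ y, ψ y ∂(ν G) = ∫ x, G x * ψ (t x) ∂μ := by
    intro G hG hG0
    simp only [ν]
    rw [integral_map ht.aemeasurable hψ.aestronglyMeasurable,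
      integral_withDensity_eq_integral_toReal_smul (by fun_prop)
        (Filter.Eventually.of_forall fun x => ENNReal.ofReal_lt_top)]
    simp [ENNReal.toReal_ofReal (hG0 _)]
  obtain ⟨M, hM⟩ := (isCompact_Icc (a := 0) (b := B)).exists_bound_of_continuousOn hψ.continuousOn
  have hbdd : ∀ G : X → ℝ, Integrable G μ → Integrable (fun x => G x * ψ (t x)) μ := fun G hG =>
    hG.mul_bdd (c := M) (hψ.measurable.comp ht).aestronglyMeasurable
      (Filter.Eventually.of_forall fun x => hM _ (htB x))
  have hfinal := (hint _ (by fun_prop) fun x => le_max_right (F x) 0).symm.trans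
    (heq ▸ hint _ (by fun_prop) fun x => le_max_right (-F x) 0)
  rw [← sub_eq_zero, ← integral_sub (hbdd _ hpos) (hbdd _ hneg)] at hfinal
  rw [← hfinal]
  congr 1
  ext x
  rw [← sub_mul, ← hsub]

end LevelSets

section Injectivity

lemma injOn_div_one_sub_norm_sq {x y : R3} (hx : ‖x‖ < 1) (hy : ‖y‖ < 1)
    (h : ∀ i, x i / (1 - ‖x‖ ^ 2) = y i / (1 - ‖y‖ ^ 2)) : x = y := by
  have hx1 : 0 < 1 - ‖x‖ ^ 2 := by nlinarith [norm_nonneg x]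
  have hy1 : 0 < 1 - ‖y‖ ^ 2 := by nlinarith [norm_nonneg y]
  have hv : (1 - ‖y‖ ^ 2) • x = (1 - ‖x‖ ^ 2) • y := by
    ext i
    have := (div_eq_div_iff hx1.ne' hy1.ne').1 (h i)
    simp only [PiLp.smul_apply, smul_eq_mul]
    linarith
  have hn := congrArg norm hv
  rw [norm_smul, norm_smul, Real.norm_of_nonneg hx1.le, Real.norm_of_nonneg hy1.le] at hn
  have hxy : ‖x‖ = ‖y‖ := by
    have : (‖x‖ - ‖y‖) * (1 + ‖x‖ * ‖y‖) = 0 := by linear_combination hn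
    rcases mul_eq_zero.1 this with h | h
    · linarith
    · nlinarith [norm_nonneg x, norm_nonneg y]
  rw [hxy] at hv
  exact smul_right_injective _ hy1.ne' hv

lemma crossSq_smul {A : Type*} [CommRing A] [Algebra ℝ A] (w : Fin 3 → A) (c : ℝ)
    (u : Fin 3 → ℝ) : crossSq w (c • u) = c ^ 2 • crossSq w u := by
  rw [Algebra.smul_def (c ^ 2) (crossSq w u)]
  simp only [crossSq, Fin.sum_univ_three, Pi.smul_apply, smul_eq_mul, map_add, map_mul, map_pow]
  ring

lemma crossSq_nonneg (w u : Fin 3 → ℝ) : 0 ≤ crossSq w u := by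
  simp only [crossSq, Algebra.algebraMap_self, RingHom.id_apply, sub_nonneg]
  rw [mul_comm]
  exact Finset.sum_mul_sq_le_sq_mul_sq _ _ _

lemma crossSq_div (w u : Fin 3 → ℝ) (c : ℝ) :
    crossSq (fun i => w i / c) u = crossSq w u / c ^ 2 := by
  simp only [crossSq, Algebra.algebraMap_self, RingHom.id_apply, Fin.sum_univ_three]
  ring

lemma crossSq_apply {X : Type*} [TopologicalSpace X] (w : Fin 3 → C(X, ℝ)) (u : Fin 3 → ℝ)
    (x : X) : crossSq w u x = crossSq (fun i => w i x) u := by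
  simp [crossSq]

/-- Integration against `f` over the compact set `K` as a functional on `C(K, ℝ)`. -/
def integralFunctional (K : Set R3) [CompactSpace K] (f : R3 → ℝ)
    (hi : Integrable (fun x : K => f x) (volume.comap Subtype.val)) : C(K, ℝ) →L[ℝ] ℝ :=
  LinearMap.mkContinuous
    { toFun := fun g => ∫ x : K, f x * g x ∂(volume.comap Subtype.val)
      map_add' := by
        intro g₁ g₂
        have h : ∀ g : C(K, ℝ),
            Integrable (fun x : K => f x * g x) (volume.comap Subtype.val) := fun g =>
          hi.mul_bdd (c := ‖g‖) g.continuous.aestronglyMeasurable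
            (Filter.Eventually.of_forall fun x => g.norm_coe_le_norm x)
        simp only [ContinuousMap.add_apply, mul_add]
        exact integral_add (h g₁) (h g₂)
      map_smul' := by
        intro c g
        simp only [ContinuousMap.smul_apply, smul_eq_mul, mul_left_comm _ c, integral_const_mul,
          RingHom.id_apply] }
    (∫ x : K, ‖f x‖ ∂(volume.comap Subtype.val))
    (by
      intro g
      rw [← integral_mul_const]
      refine norm_integral_le_of_norm_le (hi.norm.mul_const _)
        (Filter.Eventually.of_forall fun x => ?_)
      rw [norm_mul]
      gcongr
      exact g.norm_coe_le_norm x)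

/-- Level-set form of the vanishing of the interior transform. -/
lemma setIntegral_level_eq_zero {f : R3 → ℝ} {C : ℝ} (hf : Measurable f) (hC : ∀ x, |f x| ≤ C)
    {K : Set R3} (hK : MeasurableSet K) (hK1 : ∀ x ∈ K, ‖x‖ < 1) (hfK : ∀ x, x ∉ K → f x = 0)
    {α β s : ℝ} (hs : 0 < s) (hI : interiorT f (1 / (2 * s)) α β = 0) :
    ∫ x in {x : K | √(crossSq (fun i => (x : R3) i) (sphVec α β)) / (1 - ‖(x : R3)‖ ^ 2) < s},
      f x ∂(volume.comap Subtype.val) = 0 := by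
  have hm : MeasurableSet {x : K |
      √(crossSq (fun i => (x : R3) i) (sphVec α β)) / (1 - ‖(x : R3)‖ ^ 2) < s} := by
    refine measurableSet_lt ?_ measurable_const
    have := ((measurable_crossSq (sphVec α β)).sqrt).comp (measurable_subtype_coe (p := (· ∈ K)))
    exact this.div (by fun_prop)
  rw [← integral_indicator hm, ← hI, interiorT_eq_integral hf C hC (by positivity)]
  set D : R3 → ℝ := fun x => if ‖x‖ ^ 2 + 2 * (1 / (2 * s)) *
    √(crossSq (fun i => x i) (sphVec α β)) < 1 then f x else 0 with hD
  have h1 : ∫ x in K, D x = ∫ x, D x := by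
    refine setIntegral_eq_integral_of_forall_compl_eq_zero fun x hx => ?_
    simp [hD, hfK x hx]
  rw [← h1, ← integral_subtype_comap hK]
  congr 1
  ext x
  have hx : 0 < 1 - ‖(x : R3)‖ ^ 2 := by nlinarith [norm_nonneg (x : R3), hK1 x x.2]
  simp only [indicator_apply, mem_ofPred_eq, hD]
  congr 1
  rw [eq_iff_iff, div_lt_iff₀ hx, show 2 * (1 / (2 * s)) *
    √(crossSq (fun i => (x : R3) i) (sphVec α β)) =
    √(crossSq (fun i => (x : R3) i) (sphVec α β)) / s by field_simp, ← lt_sub_iff_add_lt',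
    div_lt_iff₀' hs]

lemma eq_zero_of_interiorT {f : R3 → ℝ} (hf : Continuous f) (hfc : HasCompactSupport f)
    (hball : ∀ x ∈ tsupport f, ‖x‖ < 1) (hup : ∀ x ∈ tsupport f, 0 < x 2)
    (hI : ∀ r : ℝ, 0 < r → ∀ α ∈ Icc (0:ℝ) (2 * π), ∀ β ∈ Icc (0:ℝ) π,
      interiorT f r α β = 0) : f = 0 := by
  set K := tsupport f
  have hKc : IsCompact K := hfc
  have hKm : MeasurableSet K := hKc.measurableSet
  have : CompactSpace K := isCompact_iff_compactSpace.1 hKc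
  obtain ⟨C, hC⟩ := hf.bounded_above_of_compact_support hfc
  have hfK : ∀ x, x ∉ K → f x = 0 := fun x hx => image_eq_zero_of_notMem_tsupport hx
  have hpos : ∀ x : K, 0 < 1 - ‖(x : R3)‖ ^ 2 := fun x => by
    nlinarith [norm_nonneg (x : R3), hball x x.2]
  have hfi : Integrable (fun x : K => f x) (volume.comap Subtype.val) := by
    have : Integrable (fun x : K => f x) (volume.comap Subtype.val) ↔ IntegrableOn f K :=
      (integrableOn_iff_comap_subtypeVal hKm).symm
    exact this.2 (hf.integrable_of_hasCompactSupport hfc).integrableOn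
  let w : Fin 3 → C(K, ℝ) := fun i =>
    ⟨fun x => (x : R3) i / (1 - ‖(x : R3)‖ ^ 2),
      Continuous.div (by fun_prop) (by fun_prop) fun x => (hpos x).ne'⟩
  set L := integralFunctional K f hfi
  have hmoment : ∀ u k, L (crossSq w u ^ k) = 0 := by
    intro u k
    obtain ⟨c, α, hα, β, hβ, hu⟩ := exists_sphVec_smul (WithLp.toLp 2 u)
    have hu' : u = c • (sphVec α β).ofLp := congrArg WithLp.ofLp hu
    set q : C(K, ℝ) := crossSq w (sphVec α β) with hq
    have hqx : ∀ x : K, q x =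
        (√(crossSq (fun i => (x : R3) i) (sphVec α β)) / (1 - ‖(x : R3)‖ ^ 2)) ^ 2 := by
      intro x
      rw [hq, crossSq_apply, div_pow, sq_sqrt (crossSq_nonneg _ _), ← crossSq_div]
      rfl
    have ht : ∀ x : K, √(crossSq (fun i => (x : R3) i) (sphVec α β)) / (1 - ‖(x : R3)‖ ^ 2) =
        √(q x) := fun x => by
      rw [hqx, sqrt_sq (div_nonneg (sqrt_nonneg _) (hpos x).le)]
    have hlevel := integral_mul_comp_eq_zero (μ := (volume : Measure R3).comap Subtype.val)
      (F := fun x : K => f x) (t := fun x => √(q x)) (B := √‖q‖)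
      (hf.comp continuous_subtype_val).measurable hfi q.continuous.measurable.sqrt
      (fun x => ⟨sqrt_nonneg _, sqrt_le_sqrt ((le_abs_self _).trans (q.norm_coe_le_norm x))⟩)
      (fun s hs => by
        simp only [← ht]
        exact setIntegral_level_eq_zero hf.measurable hC hKm hball hfK hs
          (hI _ (by positivity) α hα β hβ))
      (ψ := fun y => y ^ (2 * k)) (by fun_prop)
    rw [hu', crossSq_smul, smul_pow, map_smul, ← hq]
    have : L (q ^ k) = 0 := by
      rw [← hlevel]
      refine integral_congr_ae (Filter.Eventually.of_forall fun x => ?_)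
      simp only [ContinuousMap.pow_apply]
      rw [pow_mul, sq_sqrt (by rw [hqx]; positivity)]
    rw [this, smul_zero]
  have hL0 : L = 0 := by
    refine eq_zero_of_map_crossSq_pow w (fun x => div_pos (hup x x.2) (hpos x)) ?_ L hmoment
    intro x y hxy
    exact Subtype.ext (injOn_div_one_sub_norm_sq (hball x x.2) (hball y y.2) (congrFun hxy))
  have hsq : ∫ x, f x * f x = 0 := by
    rw [← setIntegral_eq_integral_of_forall_compl_eq_zero (s := K)
      (fun x hx => by simp [hfK x hx]), ← integral_subtype_comap hKm]
    exact congrArg (fun M => M ⟨fun x : K => f x, by fun_prop⟩) hL0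
  by_contra hne
  obtain ⟨x, hx⟩ := Function.ne_iff.1 hne
  have := (hf.mul hf).integral_pos_of_hasCompactSupport_nonneg_nonzero (μ := volume)
    hfc.mul_right (fun x => mul_self_nonneg _) (x := x) (by simpa using hx)
  exact this.ne' hsq

end Injectivity

/-- Corollary 2 of the paper: the spindle interior transform is injective
on smooth functions compactly supported in `B_{ε₁,ε₂} ∩ U`. -/
theorem interior_transform_injective
    (ε₁ ε₂ : ℝ) (hε₁ : 0 < ε₁) (h₁₂ : ε₁ < ε₂) (hε₂ : ε₂ < 1)
    (f : R3 → ℝ) (hf : ContDiff ℝ (⊤ : ℕ∞) f) (hfc : HasCompactSupport f)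
    (hsupp : tsupport f ⊆ hollowBall ε₁ ε₂ ∩ upperHalf)
    (hI : ∀ r : ℝ, 0 < r → ∀ α ∈ Icc (0:ℝ) (2 * π), ∀ β ∈ Icc (0:ℝ) π,
      interiorT f r α β = 0) :
    (∀ x : R3, 0 < ‖x‖ → ‖x‖ < 1 → f x = 0) ∧ f = 0 := by
  have hsub : ∀ x ∈ tsupport f, ‖x‖ < 1 ∧ 0 < x 2 := fun x hx =>
    ⟨(hsupp hx).1.2.trans hε₂, (hsupp hx).2⟩
  have h0 : f = 0 := eq_zero_of_interiorT hf.continuous hfc (fun x hx => (hsub x hx).1)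
    (fun x hx => (hsub x hx).2) hI
  exact ⟨fun x _ _ => congrFun h0 x, h0⟩
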